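/- For every Q > 0, the function J_Q : ℝ^N → ℝ defined by J_Q(x) = ((|x| − Q)_+)², where (t)_+ = max{t, 0}, is 1-uniformly convex outside the ball B_{2Q}: for all z, z' ∈ ℝ^N whose segment [z, z'] does not intersect B_{2Q} and all θ ∈ [0,1], J_Q(θz+(1−θ)z') ≤ θJ_Q(z)+(1−θ)J_Q(z') − (1/2)θ(1−θ)|z−z'|². -/

import Mathlib

open MeasureTheory Filter
open scoped InnerProductSpace RealInnerProductSpace ENNReal NNReal Topology

noncomputable section

/-- `F` is `Φ`-uniformly convex outside the ball `B_R`. -/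
def PhiUC {N : ℕ} (Φ : ℝ → ℝ) (R : ℝ) (F : EuclideanSpace ℝ (Fin N) → ℝ) : Prop :=
  ∀ z z' : EuclideanSpace ℝ (Fin N),
    (∀ w ∈ segment ℝ z z', R ≤ ‖w‖) →
    ∀ θ : ℝ, θ ∈ Set.Icc (0:ℝ) 1 →
      F (θ • z + (1 - θ) • z') ≤
        θ * F z + (1 - θ) * F z' - (1/2) * θ * (1 - θ) * Φ (‖z‖ + ‖z'‖) * ‖z - z'‖^2

/-- The subdifferential of `F` at `ξ`. -/
def SubGrad {N : ℕ} (F : EuclideanSpace ℝ (Fin N) → ℝ) (ξ : EuclideanSpace ℝ (Fin N)) :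
    Set (EuclideanSpace ℝ (Fin N)) :=
  {ζ | ∀ x, F ξ + ⟪ζ, x - ξ⟫ ≤ F x}

/-- Expansion of the squared norm of a combination with weights summing to one. -/
theorem norm_sq_smul_add_one_sub_smul {E : Type*} [NormedAddCommGroup E] [InnerProductSpace ℝ E]
    (z z' : E) (θ : ℝ) :
    ‖θ • z + (1 - θ) • z'‖ ^ 2 =
      θ * ‖z‖ ^ 2 + (1 - θ) * ‖z'‖ ^ 2 - θ * (1 - θ) * ‖z - z'‖ ^ 2 := by
  rw [norm_add_sq_real, norm_sub_sq_real, norm_smul, norm_smul, mul_pow, mul_pow,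
    real_inner_smul_left, real_inner_smul_right, Real.norm_eq_abs, Real.norm_eq_abs, sq_abs, sq_abs]
  ring

/-- The convexity defect of the norm is quadratic at combinations of norm at least `R`. -/
theorem mul_convex_defect_norm_le {E : Type*} [NormedAddCommGroup E] [InnerProductSpace ℝ E]
    {z z' : E} {R θ : ℝ} (hθ₀ : 0 ≤ θ) (hθ₁ : θ ≤ 1)
    (hw : R ≤ ‖θ • z + (1 - θ) • z'‖) :
    2 * R * (θ * ‖z‖ + (1 - θ) * ‖z'‖ - ‖θ • z + (1 - θ) • z'‖) ≤
      θ * (1 - θ) * ‖z - z'‖ ^ 2 := by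
  have hsq := norm_sq_smul_add_one_sub_smul z z' θ
  have htri : ‖θ • z + (1 - θ) • z'‖ ≤ θ * ‖z‖ + (1 - θ) * ‖z'‖ := by
    simpa only [norm_smul, Real.norm_of_nonneg hθ₀, Real.norm_of_nonneg (sub_nonneg.2 hθ₁)]
      using norm_add_le (θ • z) ((1 - θ) • z')
  set c := ‖θ • z + (1 - θ) • z'‖
  have hprod : 0 ≤ θ * (1 - θ) := mul_nonneg hθ₀ (sub_nonneg.2 hθ₁)
  have hmean := mul_nonneg (sub_nonneg.2 htri)
    (show 0 ≤ θ * ‖z‖ + (1 - θ) * ‖z'‖ + c - 2 * R by linarith)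
  have hdiff := mul_nonneg hprod (sq_nonneg (‖z‖ - ‖z'‖))
  linear_combination hmean + hdiff - hsq

/-- **Lemma A.6.** The function `J_Q(x) = ((|x| − Q)_+)²` is `1`-uniformly convex outside
the ball `B_{2Q}`. -/
theorem JQ_one_uniformly_convex
    {N : ℕ} (Q : ℝ) (hQ : 0 < Q) :
    PhiUC (fun _ => (1 : ℝ)) (2 * Q)
      (fun x : EuclideanSpace ℝ (Fin N) => (max (‖x‖ - Q) 0)^2) := by
  intro z z' hseg θ hθ
  have hz := hseg z (left_mem_segment ℝ z z')
  have hz' := hseg z' (right_mem_segment ℝ z z')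
  have hw := hseg (θ • z + (1 - θ) • z')
    ⟨θ, 1 - θ, hθ.1, sub_nonneg.2 hθ.2, add_sub_cancel θ 1, rfl⟩
  have hsq := norm_sq_smul_add_one_sub_smul z z' θ
  have hdefect := mul_convex_defect_norm_le hθ.1 hθ.2 hw
  beta_reduce
  rw [max_eq_left (by linarith), max_eq_left (by linarith), max_eq_left (by linarith)]
  linear_combination hsq + (1 / 2) * hdefect

end
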